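/- Let μ ≥ 0 and v, w ∈ C_0^∞(ℝ). Then ∫_ℝ (D^{μ}v)(D^{μ*}w) dx + ∫_ℝ (D^{μ}w)(D^{μ*}v) dx = 2 cos(μπ) ∫_ℝ (D^{μ}v)(D^{μ}w) dx. -/

import Mathlib

open MeasureTheory Real
open scoped ENNReal

noncomputable section

/-- Left Riemann–Liouville fractional integral on ℝ:
`(D^{-σ}w)(x) = (1/Γ(σ)) ∫_{-∞}^x (x-s)^(σ-1) w(s) ds`. -/
def RLIL (σ : ℝ) (w : ℝ → ℝ) (x : ℝ) : ℝ :=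
  (1 / Real.Gamma σ) * ∫ s in Set.Iio x, (x - s) ^ (σ - 1) * w s

/-- Right Riemann–Liouville fractional integral on ℝ:
`(D^{-σ*}w)(x) = (1/Γ(σ)) ∫_x^∞ (s-x)^(σ-1) w(s) ds`. -/
def RLIR (σ : ℝ) (w : ℝ → ℝ) (x : ℝ) : ℝ :=
  (1 / Real.Gamma σ) * ∫ s in Set.Ioi x, (s - x) ^ (σ - 1) * w s

/-- Left Riemann–Liouville fractional derivative of order `μ` (with `D^0` the identity):
for `μ > 0`, with `n = ⌊μ⌋ + 1` (so `n - 1 ≤ μ < n`),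
`(D^μ w)(x) = (d/dx)^n (D^{-(n-μ)}w)(x)`. -/
def RLDL (μ : ℝ) (w : ℝ → ℝ) : ℝ → ℝ :=
  if μ = 0 then w else deriv^[⌊μ⌋₊ + 1] (RLIL ((⌊μ⌋₊ : ℝ) + 1 - μ) w)

/-- Right Riemann–Liouville fractional derivative of order `μ` (with `D^{0*}` the identity):
for `μ > 0`, with `n = ⌊μ⌋ + 1` (so `n - 1 ≤ μ < n`),
`(D^{μ*} w)(x) = (-1)^n (d/dx)^n (D^{-(n-μ)*}w)(x)`. -/
def RLDR (μ : ℝ) (w : ℝ → ℝ) : ℝ → ℝ :=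
  if μ = 0 then w
  else fun x => (-1 : ℝ) ^ (⌊μ⌋₊ + 1) * deriv^[⌊μ⌋₊ + 1] (RLIR ((⌊μ⌋₊ : ℝ) + 1 - μ) w) x

/-- The truncated power `u ↦ u₊ ^ p`, vanishing for `u ≤ 0`. -/
def posPow (p u : ℝ) : ℝ := (Set.Ioi (0 : ℝ)).indicator (fun u => u ^ p) u

lemma posPow_of_pos {p u : ℝ} (hu : 0 < u) : posPow p u = u ^ p :=
  Set.indicator_of_mem (Set.mem_Ioi.2 hu) _

lemma posPow_of_nonpos {p u : ℝ} (hu : u ≤ 0) : posPow p u = 0 :=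
  Set.indicator_of_notMem (by simpa using hu) _

lemma posPow_nonneg (p u : ℝ) : 0 ≤ posPow p u :=
  Set.indicator_nonneg (fun _ hu => rpow_nonneg (le_of_lt hu) _) _

@[fun_prop]
lemma measurable_posPow (p : ℝ) : Measurable (posPow p) :=
  (measurable_id.pow_const p).indicator measurableSet_Ioi

lemma posPow_mul_self (p u : ℝ) : posPow p u * posPow p u = posPow (2 * p) u := by
  rcases le_or_gt u 0 with hu | hu
  · simp [posPow_of_nonpos hu]
  · rw [posPow_of_pos hu, posPow_of_pos hu, ← rpow_add hu, two_mul]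

lemma locallyIntegrable_posPow {p : ℝ} (hp : -1 < p) : LocallyIntegrable (posPow p) := by
  rw [locallyIntegrable_iff]
  intro K hK
  obtain ⟨R, hR⟩ := hK.isBounded.subset_closedBall 0
  have h1 : IntegrableOn (fun u : ℝ => u ^ p) (Set.Ioc 0 (max R 0)) :=
    (intervalIntegrable_iff_integrableOn_Ioc_of_le (le_max_right _ _)).1
      (intervalIntegral.intervalIntegrable_rpow' hp)
  refine (integrable_indicator_iff measurableSet_Ioi).2 ?_
  rw [IntegrableOn, Measure.restrict_restrict measurableSet_Ioi]
  refine h1.mono_set fun u hu => ⟨hu.1, le_max_of_le_left ?_⟩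
  simpa using (le_abs_self u).trans (by simpa using hR hu.2)

lemma locallyIntegrable_posPow_neg {p : ℝ} (hp : -1 < p) :
    LocallyIntegrable (fun u => posPow p (-u)) := by
  rw [locallyIntegrable_iff]
  intro K hK
  have h := (locallyIntegrable_posPow hp).integrableOn_isCompact hK.neg
  have := ((Measure.measurePreserving_neg (volume : Measure ℝ)).integrableOn_comp_preimage
    (MeasurableEquiv.neg ℝ).measurableEmbedding).2 h
  simpa [Function.comp_def] using this

/-- A nonnegative function whose lower Lebesgue integral is finite is integrable, with that
integral. -/
lemma integrable_and_integral_of_lintegral {α : Type*} [MeasurableSpace α] {ν : Measure α}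
    {f : α → ℝ} (hf : AEStronglyMeasurable f ν) (h0 : 0 ≤ᵐ[ν] f) {c : ℝ} (hc : 0 ≤ c)
    (h : ∫⁻ x, ENNReal.ofReal (f x) ∂ν = ENNReal.ofReal c) :
    Integrable f ν ∧ ∫ x, f x ∂ν = c := by
  refine ⟨⟨hf, ?_⟩, ?_⟩
  · rw [hasFiniteIntegral_iff_ofReal h0, h]
    exact ENNReal.ofReal_lt_top
  · rw [integral_eq_lintegral_of_nonneg_ae h0 hf, h, ENNReal.toReal_ofReal hc]

/-- Laplace transform of a power, as a lower Lebesgue integral. -/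
lemma lintegral_rpow_mul_exp_neg_mul {a r : ℝ} (ha : 0 < a) (hr : 0 < r) :
    ∫⁻ t in Set.Ioi (0 : ℝ), ENNReal.ofReal (t ^ (a - 1) * exp (-(r * t)))
      = ENNReal.ofReal (Gamma a * r ^ (-a)) := by
  have key := Real.integral_rpow_mul_exp_neg_mul_Ioi ha hr
  have hG := Gamma_pos_of_pos ha
  have hi : IntegrableOn (fun t : ℝ => t ^ (a - 1) * exp (-(r * t))) (Set.Ioi 0) :=
    .of_integral_ne_zero (by rw [key]; positivity)
  rw [← ofReal_integral_eq_lintegral_ofReal hi, key, one_div, inv_rpow hr.le, rpow_neg hr.le,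
    mul_comm]
  exact (ae_restrict_mem measurableSet_Ioi).mono fun t (ht : 0 < t) => by positivity

/-- The beta integral on the half line. -/
lemma lintegral_rpow_mul_add_rpow {a b h : ℝ} (ha : 0 < a) (hb : 0 < b) (hh : 0 < h) :
    ∫⁻ y in Set.Ioi (0 : ℝ), ENNReal.ofReal (y ^ (a - 1) * (y + h) ^ (-(a + b)))
      = ENNReal.ofReal (ProbabilityTheory.beta a b * h ^ (-b)) := by
  have hab := Gamma_pos_of_pos (add_pos ha hb)
  have hGa := Gamma_pos_of_pos ha
  have hGb := Gamma_pos_of_pos hb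
  have e1 : ∀ y ∈ Set.Ioi (0 : ℝ), ENNReal.ofReal (y ^ (a - 1) * (y + h) ^ (-(a + b)))
      = ∫⁻ u in Set.Ioi (0 : ℝ), ENNReal.ofReal
        ((Gamma (a + b))⁻¹ * (y ^ (a - 1) * (u ^ (a + b - 1) * exp (-((y + h) * u))))) := by
    intro y (hy : 0 < y)
    have : ∀ u : ℝ, ENNReal.ofReal
        ((Gamma (a + b))⁻¹ * (y ^ (a - 1) * (u ^ (a + b - 1) * exp (-((y + h) * u)))))
        = ENNReal.ofReal ((Gamma (a + b))⁻¹ * y ^ (a - 1)) *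
          ENNReal.ofReal (u ^ (a + b - 1) * exp (-((y + h) * u))) := fun u => by
      rw [← ENNReal.ofReal_mul (by positivity)]; ring_nf
    simp_rw [this]
    rw [lintegral_const_mul' _ _ ENNReal.ofReal_ne_top,
      lintegral_rpow_mul_exp_neg_mul (add_pos ha hb) (by positivity),
      ← ENNReal.ofReal_mul (by positivity)]
    congr 1
    field_simp
  rw [setLIntegral_congr_fun measurableSet_Ioi e1, lintegral_lintegral_swap (by fun_prop)]
  have e2 : ∀ u ∈ Set.Ioi (0 : ℝ), ∫⁻ y in Set.Ioi (0 : ℝ), ENNReal.ofReal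
        ((Gamma (a + b))⁻¹ * (y ^ (a - 1) * (u ^ (a + b - 1) * exp (-((y + h) * u)))))
      = ENNReal.ofReal (Gamma a / Gamma (a + b)) *
        ENNReal.ofReal (u ^ (b - 1) * exp (-(h * u))) := by
    intro u (hu : 0 < u)
    have : ∀ y : ℝ, ENNReal.ofReal
        ((Gamma (a + b))⁻¹ * (y ^ (a - 1) * (u ^ (a + b - 1) * exp (-((y + h) * u)))))
        = ENNReal.ofReal ((Gamma (a + b))⁻¹ * u ^ (a + b - 1) * exp (-(h * u))) *
          ENNReal.ofReal (y ^ (a - 1) * exp (-(u * y))) := fun y => by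
      rw [← ENNReal.ofReal_mul (by positivity),
        show -((y + h) * u) = -(h * u) + -(u * y) by ring, exp_add]
      ring_nf
    simp_rw [this]
    rw [lintegral_const_mul' _ _ ENNReal.ofReal_ne_top, lintegral_rpow_mul_exp_neg_mul ha hu,
      ← ENNReal.ofReal_mul (by positivity), ← ENNReal.ofReal_mul (by positivity),
      show b - 1 = (a + b - 1) + -a by ring, rpow_add hu]
    congr 1
    field_simp
  rw [setLIntegral_congr_fun measurableSet_Ioi e2,
    lintegral_const_mul' _ _ ENNReal.ofReal_ne_top, lintegral_rpow_mul_exp_neg_mul hb hh,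
    ← ENNReal.ofReal_mul (by positivity), ProbabilityTheory.beta]
  congr 1
  ring

lemma lintegral_rpow_mul_rpow_sub {a q h : ℝ} (ha : 0 < a) (hq : q < 0) (haq : 0 < q + a)
    (hb : 0 < 1 - q - a) (hh : 0 < h) :
    ∫⁻ y in Set.Ioi (0 : ℝ), ENNReal.ofReal (y ^ (a - 1) * (y ^ q - (y + h) ^ q))
      = ENNReal.ofReal (-q * ProbabilityTheory.beta a (1 - q - a) / (q + a) * h ^ (q + a)) := by
  have hB := ProbabilityTheory.beta_pos ha hb
  have hnq : 0 < -q := by linarith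
  have e1 : ∀ y ∈ Set.Ioi (0 : ℝ), ENNReal.ofReal (y ^ (a - 1) * (y ^ q - (y + h) ^ q))
      = ∫⁻ u in Set.Ioc (0 : ℝ) h, ENNReal.ofReal
        (-q * (y ^ (a - 1) * (y + u) ^ (q - 1))) := by
    intro y (hy : 0 < y)
    have hd : ∀ u ∈ Set.uIcc 0 h, HasDerivAt (fun u => -(y ^ (a - 1) * (y + u) ^ q))
        (-q * (y ^ (a - 1) * (y + u) ^ (q - 1))) u := by
      intro u hu
      rw [Set.uIcc_of_le hh.le] at hu
      have : HasDerivAt (fun u => (y + u) ^ q) (1 * q * (y + u) ^ (q - 1)) u :=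
        ((hasDerivAt_id u).const_add y).rpow_const (Or.inl (by simp only [id]; linarith [hu.1]))
      exact (this.const_mul (y ^ (a - 1))).fun_neg.congr_deriv (by ring)
    have hc : IntervalIntegrable (fun u => -q * (y ^ (a - 1) * (y + u) ^ (q - 1))) volume 0 h := by
      apply ContinuousOn.intervalIntegrable
      rw [Set.uIcc_of_le hh.le]
      refine continuousOn_const.mul (continuousOn_const.mul ?_)
      exact ContinuousOn.rpow_const (by fun_prop) fun u hu => Or.inl (by linarith [hu.1])
    have := intervalIntegral.integral_eq_sub_of_hasDerivAt hd hc
    rw [← ofReal_integral_eq_lintegral_ofReal, ← intervalIntegral.integral_of_le hh.le, this]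
    · congr 1
      rw [add_zero]; ring
    · exact (intervalIntegrable_iff_integrableOn_Ioc_of_le hh.le).1 hc
    · exact (ae_restrict_mem measurableSet_Ioc).mono fun u hu => by
        have := hu.1
        positivity
  rw [setLIntegral_congr_fun measurableSet_Ioi e1, lintegral_lintegral_swap (by fun_prop)]
  have e2 : ∀ u ∈ Set.Ioc (0 : ℝ) h, ∫⁻ y in Set.Ioi (0 : ℝ), ENNReal.ofReal
        (-q * (y ^ (a - 1) * (y + u) ^ (q - 1)))
      = ENNReal.ofReal (-q * ProbabilityTheory.beta a (1 - q - a) * u ^ (q + a - 1)) := by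
    intro u hu
    simp_rw [ENNReal.ofReal_mul hnq.le]
    rw [lintegral_const_mul' _ _ ENNReal.ofReal_ne_top]
    have := lintegral_rpow_mul_add_rpow ha hb hu.1
    rw [show -(a + (1 - q - a)) = q - 1 by ring, show -(1 - q - a) = q + a - 1 by ring] at this
    rw [this, ← ENNReal.ofReal_mul hnq.le, mul_assoc]
  rw [setLIntegral_congr_fun measurableSet_Ioc e2]
  have hc : IntervalIntegrable (fun u : ℝ => u ^ (q + a - 1)) volume 0 h :=
    intervalIntegral.intervalIntegrable_rpow' (by linarith)
  rw [← ofReal_integral_eq_lintegral_ofReal, integral_const_mul,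
    ← intervalIntegral.integral_of_le hh.le, integral_rpow (Or.inl (by linarith))]
  · congr 1
    rw [sub_add_cancel, zero_rpow haq.ne']; ring
  · exact ((intervalIntegrable_iff_integrableOn_Ioc_of_le hh.le).1 hc).const_mul _
  · exact (ae_restrict_mem measurableSet_Ioc).mono fun u hu => by
      have := hu.1
      positivity

lemma integral_posPow_mul_posPow_sub {σ h : ℝ} (hσ : 0 < σ) (hh : 0 < h) :
    Integrable (fun y => posPow (σ - 1) y * posPow (σ - 1) (h - y)) ∧
      ∫ y, posPow (σ - 1) y * posPow (σ - 1) (h - y)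
        = ProbabilityTheory.beta σ σ * h ^ (2 * σ - 1) := by
  have hB := ProbabilityTheory.beta_pos hσ hσ
  have e : (fun y => posPow (σ - 1) y * posPow (σ - 1) (h - y))
      = (Set.Ioo 0 h).indicator (fun y => y ^ (σ - 1) * (h - y) ^ (σ - 1)) := by
    ext y
    by_cases hy : y ∈ Set.Ioo 0 h
    · rw [Set.indicator_of_mem hy, posPow_of_pos hy.1, posPow_of_pos (by linarith [hy.2])]
    · rw [Set.indicator_of_notMem hy]
      rcases le_or_gt y 0 with h0 | h0
      · rw [posPow_of_nonpos h0, zero_mul]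
      · rw [posPow_of_nonpos (u := h - y), mul_zero]
        by_contra hc
        exact hy ⟨h0, by linarith⟩
  have key : ∫ y in Set.Ioo 0 h, y ^ (σ - 1) * (h - y) ^ (σ - 1)
      = ProbabilityTheory.beta σ σ * h ^ (2 * σ - 1) := by
    have hc := Complex.betaIntegral_scaled σ σ hh
    rw [Complex.betaIntegral_eq_Gamma_mul_div _ _ (by simpa) (by simpa),
      intervalIntegral.integral_of_le hh.le, integral_Ioc_eq_integral_Ioo] at hc
    have e3 : ∫ y in Set.Ioo 0 h, (y : ℂ) ^ ((σ : ℂ) - 1) * ((h : ℂ) - y) ^ ((σ : ℂ) - 1)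
        = ((∫ y in Set.Ioo 0 h, y ^ (σ - 1) * (h - y) ^ (σ - 1) : ℝ) : ℂ) := by
      rw [← integral_complex_ofReal]
      refine setIntegral_congr_fun measurableSet_Ioo fun y hy => ?_
      have h2 : 0 ≤ h - y := by linarith [hy.2]
      simp only [Complex.ofReal_mul, Complex.ofReal_cpow hy.1.le, Complex.ofReal_cpow h2]
      push_cast
      rfl
    rw [e3] at hc
    apply Complex.ofReal_injective
    rw [hc, ProbabilityTheory.beta, Complex.ofReal_mul, Complex.ofReal_cpow hh.le]
    push_cast
    rw [← Complex.Gamma_ofReal, ← Complex.Gamma_ofReal, mul_comm, two_mul]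
    push_cast
    rfl
  rw [e, integrable_indicator_iff measurableSet_Ioo, integral_indicator measurableSet_Ioo, key]
  refine ⟨.of_integral_ne_zero ?_, rfl⟩
  rw [key]
  positivity

lemma integral_posPow_mul_posPow_add {σ h : ℝ} (hσ : 0 < σ) (hσ' : σ < 1 / 2) (hh : 0 < h) :
    Integrable (fun y => posPow (σ - 1) y * posPow (σ - 1) (y + h)) ∧
      ∫ y, posPow (σ - 1) y * posPow (σ - 1) (y + h)
        = ProbabilityTheory.beta σ (1 - 2 * σ) * h ^ (2 * σ - 1) := by
  have hb : 0 < 1 - 2 * σ := by linarith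
  have hB := ProbabilityTheory.beta_pos hσ hb
  have e : (fun y => posPow (σ - 1) y * posPow (σ - 1) (y + h))
      = (Set.Ioi 0).indicator (fun y => y ^ (σ - 1) * (y + h) ^ (σ - 1)) := by
    ext y
    by_cases hy : 0 < y
    · rw [Set.indicator_of_mem (Set.mem_Ioi.2 hy), posPow_of_pos hy,
        posPow_of_pos (by positivity)]
    · rw [Set.indicator_of_notMem (by simpa using hy), posPow_of_nonpos (not_lt.1 hy), zero_mul]
  rw [e, integrable_indicator_iff measurableSet_Ioi, integral_indicator measurableSet_Ioi]
  refine integrable_and_integral_of_lintegral (by fun_prop) ?_ (by positivity) ?_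
  · filter_upwards [ae_restrict_mem measurableSet_Ioi] with y (hy : 0 < y)
    positivity
  · have := lintegral_rpow_mul_add_rpow hσ hb hh
    rwa [show -(σ + (1 - 2 * σ)) = σ - 1 by ring, neg_sub] at this

lemma integral_posPow_mul_posPow_sub_posPow_add {a q h : ℝ} (ha : 0 < a) (hq : q < 0)
    (haq : 0 < q + a) (hb : 0 < 1 - q - a) (hh : 0 < h) :
    Integrable (fun y => posPow (a - 1) y * (posPow q y - posPow q (y + h))) ∧
      ∫ y, posPow (a - 1) y * (posPow q y - posPow q (y + h))
        = -q * ProbabilityTheory.beta a (1 - q - a) / (q + a) * h ^ (q + a) := by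
  have hB := ProbabilityTheory.beta_pos ha hb
  have hnq : 0 < -q := by linarith
  have e : (fun y => posPow (a - 1) y * (posPow q y - posPow q (y + h)))
      = (Set.Ioi 0).indicator (fun y => y ^ (a - 1) * (y ^ q - (y + h) ^ q)) := by
    ext y
    by_cases hy : 0 < y
    · rw [Set.indicator_of_mem (Set.mem_Ioi.2 hy), posPow_of_pos hy, posPow_of_pos hy,
        posPow_of_pos (by positivity)]
    · rw [Set.indicator_of_notMem (by simpa using hy), posPow_of_nonpos (not_lt.1 hy), zero_mul]
  rw [e, integrable_indicator_iff measurableSet_Ioi, integral_indicator measurableSet_Ioi]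
  refine integrable_and_integral_of_lintegral (by fun_prop) ?_ (by positivity)
    (lintegral_rpow_mul_rpow_sub ha hq haq hb hh)
  filter_upwards [ae_restrict_mem measurableSet_Ioi] with y (hy : 0 < y)
  have : (y + h) ^ q ≤ y ^ q := rpow_le_rpow_of_nonpos hy (by linarith) hq.le
  exact mul_nonneg (by positivity) (by linarith)

lemma posPow_mul_posPow_sub_posPow_add_nonneg {p q h : ℝ} (hq : q ≤ 0) (hh : 0 ≤ h) (y : ℝ) :
    0 ≤ posPow p y * (posPow q y - posPow q (y + h)) := by
  rcases le_or_gt y 0 with hy | hy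
  · simp [posPow_of_nonpos hy]
  · refine mul_nonneg (posPow_nonneg _ _) (sub_nonneg.2 ?_)
    rw [posPow_of_pos hy, posPow_of_pos (by positivity)]
    exact rpow_le_rpow_of_nonpos hy (by linarith) hq

/-- A truncated power of exponent in `(-1, 0)` and its translates have the same regularized
integral over the line. -/
lemma integral_posPow_sub_posPow_add {q h : ℝ} (hq : q < 0) (hq' : -1 < q) (hh : 0 < h) :
    Integrable (fun y => posPow q y - posPow q (y + h)) ∧
      ∫ y, (posPow q y - posPow q (y + h)) = 0 ∧
      ∫ y, |posPow q y - posPow q (y + h)| ≤ 2 / (q + 1) * h ^ (q + 1) := by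
  have hq1 : 0 < q + 1 := by linarith
  obtain ⟨iA, vA⟩ := integral_posPow_mul_posPow_sub_posPow_add one_pos hq hq1
    (by linarith) hh
  have hB : ProbabilityTheory.beta 1 (1 - q - 1) = 1 / -q := by
    have hnq : -q ≠ 0 := by linarith
    have := Gamma_pos_of_pos (s := -q) (by linarith)
    rw [ProbabilityTheory.beta, show 1 - q - 1 = -q by ring, add_comm 1, Gamma_add_one hnq,
      Gamma_one]
    field_simp
  have hnq : -q ≠ 0 := by linarith
  have vA' : ∫ y, posPow (1 - 1) y * (posPow q y - posPow q (y + h)) = h ^ (q + 1) / (q + 1) := by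
    rw [vA, hB, mul_one_div_cancel hnq]; ring
  set A : ℝ → ℝ := fun y => posPow (1 - 1) y * (posPow q y - posPow q (y + h)) with hA
  have A0 : ∀ y, 0 ≤ A y := posPow_mul_posPow_sub_posPow_add_nonneg hq.le hh.le
  set F : ℝ → ℝ := (Set.Ioc 0 h).indicator (fun u => u ^ q) with hF
  have F0 : ∀ y, 0 ≤ F y := Set.indicator_nonneg fun u hu => rpow_nonneg hu.1.le _
  have iF : Integrable F := (integrable_indicator_iff measurableSet_Ioc).2
    ((intervalIntegrable_iff_integrableOn_Ioc_of_le hh.le).1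
      (intervalIntegral.intervalIntegrable_rpow' hq'))
  have vF : ∫ u, F u = h ^ (q + 1) / (q + 1) := by
    rw [hF, integral_indicator measurableSet_Ioc, ← intervalIntegral.integral_of_le hh.le,
      integral_rpow (Or.inl hq'), zero_rpow hq1.ne', sub_zero]
  have iF' : Integrable (fun y => F (y + h)) := iF.comp_add_right h
  have vF' : ∫ y, F (y + h) = h ^ (q + 1) / (q + 1) := by
    rw [integral_add_right_eq_self F h, vF]
  have e : ∀ y, posPow q y - posPow q (y + h) = A y - F (y + h) := by
    intro y
    rcases lt_or_ge 0 y with hy | hy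
    · have : F (y + h) = 0 := Set.indicator_of_notMem (fun hm => by linarith [hm.2]) _
      simp [this, hA, posPow_of_pos hy (p := 0)]
    · simp only [hA, posPow_of_nonpos hy, zero_mul, zero_sub, neg_inj]
      rcases lt_or_ge 0 (y + h) with hy2 | hy2
      · rw [posPow_of_pos hy2, hF, Set.indicator_of_mem (Set.mem_Ioc.2 ⟨hy2, by linarith⟩)]
      · rw [posPow_of_nonpos hy2]
        exact (Set.indicator_of_notMem (fun hm => by linarith [hm.1]) _).symm
  simp_rw [e]
  refine ⟨iA.sub iF', ?_, ?_⟩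
  · rw [integral_sub iA iF', vA', vF', sub_self]
  · calc ∫ y, |A y - F (y + h)| ≤ ∫ y, (A y + F (y + h)) := by
          refine integral_mono (iA.sub iF').abs (iA.add iF') fun y => ?_
          have h1 := A0 y
          have h2 := F0 (y + h)
          exact abs_le.2 ⟨by linarith, by linarith⟩
      _ = 2 / (q + 1) * h ^ (q + 1) := by
          rw [integral_add iA iF', vA', vF']; ring

/-- `k` is the integral of the kernel `Φ` in its first variable off the diagonal, with an absolute
bound by a power of the distance to the diagonal. -/
def IsKernelIntegral (Φ : ℝ → ℝ → ℝ → ℝ) (k : ℝ → ℝ → ℝ) (C p : ℝ) : Prop :=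
  ∀ s t, s ≠ t → Integrable (fun x => Φ x s t) ∧ ∫ x, Φ x s t = k s t ∧
    ∫ x, |Φ x s t| ≤ C * |s - t| ^ p

lemma ae_fst_ne_snd : ∀ᵐ z : ℝ × ℝ, z.1 ≠ z.2 := by
  rw [ae_iff, Measure.volume_eq_prod]
  have hm : MeasurableSet {z : ℝ × ℝ | ¬ z.1 ≠ z.2} := by
    simpa using measurableSet_eq_fun measurable_fst measurable_snd
  rw [Measure.measure_prod_null hm]
  refine ae_of_all _ fun s => ?_
  simp

lemma integrable_mul_mul_abs_sub_rpow {f g : ℝ → ℝ} (hf : Continuous f) (hfs : HasCompactSupport f)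
    (hg : Continuous g) (hgs : HasCompactSupport g) {p : ℝ} (hp : -1 < p) :
    Integrable (fun z : ℝ × ℝ => f z.1 * g z.2 * |z.1 - z.2| ^ p) := by
  obtain ⟨R, hR⟩ := (hfs.isCompact.union hgs.isCompact).isBounded.subset_closedBall 0
  have hfR : ∀ s, f s ≠ 0 → |s| ≤ R := fun s hs => by
    simpa using hR (Or.inl (subset_tsupport f hs))
  have hgR : ∀ s, g s ≠ 0 → |s| ≤ R := fun s hs => by
    simpa using hR (Or.inr (subset_tsupport g hs))
  set N : ℝ → ℝ := (Set.Icc (-(2 * R)) (2 * R)).indicator fun u => |u| ^ p with hN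
  have hloc : LocallyIntegrable (fun u : ℝ => |u| ^ p) := by
    have hP := locallyIntegrable_posPow hp
    have hP' := locallyIntegrable_posPow_neg hp
    have e : (fun u : ℝ => |u| ^ p) =ᵐ[volume] fun u => posPow p u + posPow p (-u) := by
      filter_upwards [Measure.ae_ne volume (0 : ℝ)] with u hu
      rcases lt_or_gt_of_ne hu with h | h
      · rw [posPow_of_nonpos h.le, posPow_of_pos (by linarith), abs_of_neg h, zero_add]
      · rw [posPow_of_pos h, posPow_of_nonpos (by linarith), abs_of_pos h, add_zero]
    rw [locallyIntegrable_iff]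
    intro K hK
    refine ((hP.add hP').integrableOn_isCompact hK).congr ?_
    filter_upwards [ae_restrict_of_ae e] with u hu using hu.symm
  have iN : Integrable N := (integrable_indicator_iff measurableSet_Icc).2
    (hloc.integrableOn_isCompact isCompact_Icc)
  have ig : Integrable g := hg.integrable_of_hasCompactSupport hgs
  have h1 : Integrable (fun z : ℝ × ℝ => g z.2 * N (z.1 - z.2)) (volume.prod volume) :=
    ig.convolution_integrand (ContinuousLinearMap.mul ℝ ℝ) iN
  obtain ⟨C, hC⟩ := hf.bounded_above_of_compact_support hfs
  have h2 : Integrable (fun z : ℝ × ℝ => f z.1 * (g z.2 * N (z.1 - z.2))) :=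
    h1.bdd_mul (c := C) (by fun_prop) (ae_of_all _ fun z => hC z.1)
  refine h2.congr (ae_of_all _ fun z => ?_)
  by_cases hfz : f z.1 = 0
  · simp [hfz]
  by_cases hgz : g z.2 = 0
  · simp [hgz]
  have h3 := abs_le.1 (hfR _ hfz)
  have h4 := abs_le.1 (hgR _ hgz)
  have : N (z.1 - z.2) = |z.1 - z.2| ^ p :=
    Set.indicator_of_mem (s := Set.Icc (-(2 * R)) (2 * R)) (f := fun u : ℝ => |u| ^ p)
      ⟨by linarith, by linarith⟩
  simp only [this, mul_assoc]

namespace IsKernelIntegral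

variable {Φ : ℝ → ℝ → ℝ → ℝ} {k : ℝ → ℝ → ℝ} {C p : ℝ} {f g : ℝ → ℝ}

lemma integrable (h : IsKernelIntegral Φ k C p)
    (hΦ : Measurable fun z : ℝ × ℝ × ℝ => Φ z.1 z.2.1 z.2.2) (hp : -1 < p)
    (hf : Continuous f) (hfs : HasCompactSupport f) (hg : Continuous g)
    (hgs : HasCompactSupport g) :
    Integrable (fun z : ℝ × ℝ × ℝ => f z.2.1 * g z.2.2 * Φ z.1 z.2.1 z.2.2)
      (volume.prod volume) := by
  have hm : Measurable fun z : ℝ × ℝ × ℝ => f z.2.1 * g z.2.2 * Φ z.1 z.2.1 z.2.2 := by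
    have := hf.measurable
    have := hg.measurable
    fun_prop
  rw [integrable_prod_iff' hm.aestronglyMeasurable]
  refine ⟨?_, ?_⟩
  · filter_upwards [ae_fst_ne_snd] with z hz
    exact (h z.1 z.2 hz).1.const_mul _
  · refine ((integrable_mul_mul_abs_sub_rpow hf hfs hg hgs hp).norm.const_mul C).mono' ?_ ?_
    · exact (hm.aestronglyMeasurable.norm.prod_swap).integral_prod_right'
    · filter_upwards [ae_fst_ne_snd] with z hz
      have h3 := (h z.1 z.2 hz).2.2
      simp only [norm_mul, norm_eq_abs]
      rw [integral_const_mul, abs_of_nonneg (mul_nonneg (by positivity)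
        (integral_nonneg fun _ => abs_nonneg _)), abs_of_nonneg (rpow_nonneg (abs_nonneg _) p)]
      calc |f z.1| * |g z.2| * ∫ x, |Φ x z.1 z.2|
          ≤ |f z.1| * |g z.2| * (C * |z.1 - z.2| ^ p) := by gcongr
        _ = _ := by ring

lemma integral_integral (h : IsKernelIntegral Φ k C p)
    (hΦ : Measurable fun z : ℝ × ℝ × ℝ => Φ z.1 z.2.1 z.2.2) (hp : -1 < p)
    (hf : Continuous f) (hfs : HasCompactSupport f) (hg : Continuous g)
    (hgs : HasCompactSupport g) :
    ∫ x, ∫ z : ℝ × ℝ, f z.1 * g z.2 * Φ x z.1 z.2 = ∫ z : ℝ × ℝ, f z.1 * g z.2 * k z.1 z.2 := by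
  rw [integral_integral_swap (f := fun x (z : ℝ × ℝ) => f z.1 * g z.2 * Φ x z.1 z.2)
    (h.integrable hΦ hp hf hfs hg hgs)]
  refine integral_congr_ae ?_
  filter_upwards [ae_fst_ne_snd] with z hz
  rw [integral_const_mul, (h z.1 z.2 hz).2.1]

end IsKernelIntegral

lemma isKernelIntegral_left_right {σ : ℝ} (hσ : 0 < σ) :
    IsKernelIntegral (fun x s t => posPow (σ - 1) (x - s) * posPow (σ - 1) (t - x))
      (fun s t => ProbabilityTheory.beta σ σ * posPow (2 * σ - 1) (t - s))
      (ProbabilityTheory.beta σ σ) (2 * σ - 1) := by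
  intro s t hst
  have hB := ProbabilityTheory.beta_pos hσ hσ
  have h0 : ∀ x, 0 ≤ posPow (σ - 1) (x - s) * posPow (σ - 1) (t - x) := fun x =>
    mul_nonneg (posPow_nonneg _ _) (posPow_nonneg _ _)
  simp_rw [abs_of_nonneg (h0 _)]
  rcases lt_or_gt_of_ne hst with hlt | hgt
  · have hh : 0 < t - s := sub_pos.2 hlt
    obtain ⟨i, v⟩ := integral_posPow_mul_posPow_sub hσ hh
    have e : (fun x => posPow (σ - 1) (x - s) * posPow (σ - 1) (t - x))
        = fun x => (fun y => posPow (σ - 1) y * posPow (σ - 1) (t - s - y)) (x - s) := by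
      ext x; simp only; congr 2; ring
    have v' : ∫ x, posPow (σ - 1) (x - s) * posPow (σ - 1) (t - x)
        = ProbabilityTheory.beta σ σ * (t - s) ^ (2 * σ - 1) := by
      rw [e, integral_sub_right_eq_self
        (fun y => posPow (σ - 1) y * posPow (σ - 1) (t - s - y)) s, v]
    refine ⟨e ▸ i.comp_sub_right s, ?_, ?_⟩
    · rw [v', posPow_of_pos hh]
    · rw [v', abs_sub_comm, abs_of_pos hh]
  · have e : ∀ x, posPow (σ - 1) (x - s) * posPow (σ - 1) (t - x) = 0 := by
      intro x
      rcases le_or_gt x s with h | h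
      · rw [posPow_of_nonpos (by linarith), zero_mul]
      · rw [posPow_of_nonpos (u := t - x) (by linarith), mul_zero]
    simp_rw [e]
    rw [posPow_of_nonpos (by linarith)]
    refine ⟨integrable_zero _ _ _, by simp, ?_⟩
    rw [integral_zero]
    positivity

lemma isKernelIntegral_left_left {σ : ℝ} (hσ : 0 < σ) (hσ' : σ < 1 / 2) :
    IsKernelIntegral (fun x s t => posPow (σ - 1) (x - s) * posPow (σ - 1) (x - t))
      (fun s t => ProbabilityTheory.beta σ (1 - 2 * σ) * |s - t| ^ (2 * σ - 1))
      (ProbabilityTheory.beta σ (1 - 2 * σ)) (2 * σ - 1) := by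
  have main : ∀ s t : ℝ, t < s →
      Integrable (fun x => posPow (σ - 1) (x - s) * posPow (σ - 1) (x - t)) ∧
      ∫ x, posPow (σ - 1) (x - s) * posPow (σ - 1) (x - t)
        = ProbabilityTheory.beta σ (1 - 2 * σ) * |s - t| ^ (2 * σ - 1) := by
    intro s t hlt
    have hh : 0 < s - t := sub_pos.2 hlt
    obtain ⟨i, v⟩ := integral_posPow_mul_posPow_add hσ hσ' hh
    have e : (fun x => posPow (σ - 1) (x - s) * posPow (σ - 1) (x - t))
        = fun x => (fun y => posPow (σ - 1) y * posPow (σ - 1) (y + (s - t))) (x - s) := by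
      ext x; simp only; congr 2; ring
    refine ⟨e ▸ i.comp_sub_right s, ?_⟩
    rw [e, integral_sub_right_eq_self
      (fun y => posPow (σ - 1) y * posPow (σ - 1) (y + (s - t))) s, v, abs_of_pos hh]
  intro s t hst
  have h0 : ∀ x, 0 ≤ posPow (σ - 1) (x - s) * posPow (σ - 1) (x - t) := fun x =>
    mul_nonneg (posPow_nonneg _ _) (posPow_nonneg _ _)
  simp_rw [abs_of_nonneg (h0 _)]
  rcases lt_or_gt_of_ne hst with hlt | hgt
  · obtain ⟨i, v⟩ := main t s hlt
    simp_rw [mul_comm (posPow (σ - 1) (_ - t)), abs_sub_comm t s] at i v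
    exact ⟨i, v, v.le⟩
  · obtain ⟨i, v⟩ := main s t hgt
    exact ⟨i, v, v.le⟩

lemma isKernelIntegral_left_left_sub {σ : ℝ} (hσ : 1 / 2 < σ) (hσ' : σ < 1) :
    IsKernelIntegral
      (fun x s t => posPow (σ - 1) (x - s) * posPow (σ - 1) (x - t)
        - posPow (2 * σ - 2) (x - s))
      (fun s t => -((1 - σ) * ProbabilityTheory.beta σ (2 - 2 * σ) / (2 * σ - 1))
        * |s - t| ^ (2 * σ - 1))
      ((1 - σ) * ProbabilityTheory.beta σ (2 - 2 * σ) / (2 * σ - 1) + 2 / (2 * σ - 1))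
      (2 * σ - 1) := by
  set c := (1 - σ) * ProbabilityTheory.beta σ (2 - 2 * σ) / (2 * σ - 1) with hc
  have main : ∀ s t : ℝ, t < s →
      Integrable (fun x => posPow (2 * σ - 2) (x - s)
        - posPow (σ - 1) (x - s) * posPow (σ - 1) (x - t)) ∧
      ∫ x, (posPow (2 * σ - 2) (x - s) - posPow (σ - 1) (x - s) * posPow (σ - 1) (x - t))
        = c * (s - t) ^ (2 * σ - 1) ∧
      ∀ x, 0 ≤ posPow (2 * σ - 2) (x - s) - posPow (σ - 1) (x - s) * posPow (σ - 1) (x - t) := by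
    intro s t hlt
    have hh : 0 < s - t := sub_pos.2 hlt
    obtain ⟨i, v⟩ := integral_posPow_mul_posPow_sub_posPow_add (a := σ) (q := σ - 1) (h := s - t)
      (by linarith) (by linarith) (by linarith) (by linarith) hh
    have e : (fun x => posPow (2 * σ - 2) (x - s)
          - posPow (σ - 1) (x - s) * posPow (σ - 1) (x - t))
        = fun x => (fun y => posPow (σ - 1) y *
          (posPow (σ - 1) y - posPow (σ - 1) (y + (s - t)))) (x - s) := by
      ext x
      simp only
      rw [mul_sub, posPow_mul_self, show 2 * (σ - 1) = 2 * σ - 2 by ring,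
        show x - s + (s - t) = x - t by ring]
    refine ⟨e ▸ i.comp_sub_right s, ?_, fun x => ?_⟩
    · rw [e, integral_sub_right_eq_self (fun y => posPow (σ - 1) y *
          (posPow (σ - 1) y - posPow (σ - 1) (y + (s - t)))) s, v, hc,
        show 1 - (σ - 1) - σ = 2 - 2 * σ by ring, show σ - 1 + σ = 2 * σ - 1 by ring, neg_sub]
    · exact (congrFun e x) ▸ posPow_mul_posPow_sub_posPow_add_nonneg (by linarith) hh.le _
  have h2 : 0 < 2 * σ - 1 := by linarith
  intro s t hst
  rcases lt_or_gt_of_ne hst with hlt | hgt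
  · have hh : 0 < t - s := sub_pos.2 hlt
    obtain ⟨i, v, n⟩ := main t s hlt
    obtain ⟨j, w, b⟩ := integral_posPow_sub_posPow_add (q := 2 * σ - 2) (by linarith)
      (by linarith) hh
    have e2 : (fun x => posPow (2 * σ - 2) (x - t) - posPow (2 * σ - 2) (x - s))
        = fun x => (fun y => posPow (2 * σ - 2) y - posPow (2 * σ - 2) (y + (t - s))) (x - t) := by
      ext x; simp only; congr 2; ring
    have j' : Integrable fun x => posPow (2 * σ - 2) (x - t) - posPow (2 * σ - 2) (x - s) :=
      e2 ▸ j.comp_sub_right t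
    have w' : ∫ x, (posPow (2 * σ - 2) (x - t) - posPow (2 * σ - 2) (x - s)) = 0 := by
      rw [e2, integral_sub_right_eq_self
        (fun y => posPow (2 * σ - 2) y - posPow (2 * σ - 2) (y + (t - s))) t, w]
    have b' : ∫ x, |posPow (2 * σ - 2) (x - t) - posPow (2 * σ - 2) (x - s)|
        ≤ 2 / (2 * σ - 1) * (t - s) ^ (2 * σ - 1) := by
      rw [show 2 * σ - 2 + 1 = 2 * σ - 1 by ring] at b
      refine le_trans (le_of_eq ?_) b
      rw [← integral_sub_right_eq_self
        (fun y => |posPow (2 * σ - 2) y - posPow (2 * σ - 2) (y + (t - s))|) t]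
      exact integral_congr_ae (ae_of_all _ fun x => congrArg _ (congrFun e2 x))
    set A : ℝ → ℝ := fun x => posPow (2 * σ - 2) (x - t)
      - posPow (σ - 1) (x - t) * posPow (σ - 1) (x - s)
    set D : ℝ → ℝ := fun x => posPow (2 * σ - 2) (x - t) - posPow (2 * σ - 2) (x - s)
    have e3 : ∀ x, posPow (σ - 1) (x - s) * posPow (σ - 1) (x - t)
        - posPow (2 * σ - 2) (x - s) = D x - A x := fun x => by simp only [A, D]; ring
    simp_rw [e3]
    rw [abs_sub_comm s t, abs_of_pos hh]
    refine ⟨j'.sub i, ?_, ?_⟩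
    · rw [integral_sub j' i, w', v]; ring
    · calc ∫ x, |D x - A x| ≤ ∫ x, (|D x| + A x) := by
            refine integral_mono (j'.sub i).abs (j'.abs.add i) fun x => ?_
            exact (abs_sub _ _).trans_eq (by rw [abs_of_nonneg (n x)])
        _ = (∫ x, |D x|) + ∫ x, A x := integral_add j'.abs i
        _ ≤ _ := by rw [v]; linarith
  · have hh : 0 < s - t := sub_pos.2 hgt
    obtain ⟨i, v, n⟩ := main s t hgt
    have e3 : ∀ x, posPow (σ - 1) (x - s) * posPow (σ - 1) (x - t)
        - posPow (2 * σ - 2) (x - s) = -(posPow (2 * σ - 2) (x - s)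
        - posPow (σ - 1) (x - s) * posPow (σ - 1) (x - t)) := fun x => by ring
    simp_rw [e3, abs_neg, abs_of_nonneg (n _)]
    rw [abs_of_pos hh]
    refine ⟨i.neg, ?_, ?_⟩
    · rw [integral_neg, v]; ring
    · rw [v, add_mul]
      have : 0 ≤ 2 / (2 * σ - 1) * (s - t) ^ (2 * σ - 1) := by positivity
      linarith

lemma beta_eq_two_mul_cos_mul_beta {σ : ℝ} (hσ : 0 < σ) (hσ' : σ < 1 / 2) :
    ProbabilityTheory.beta σ σ
      = 2 * cos (σ * π) * ProbabilityTheory.beta σ (1 - 2 * σ) := by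
  have h1 := Gamma_mul_Gamma_one_sub σ
  have h2 := Gamma_mul_Gamma_one_sub (2 * σ)
  have hπ := pi_pos
  have hs : 0 < sin (π * σ) := sin_pos_of_pos_of_lt_pi (by positivity) (by nlinarith)
  have hc : 0 < cos (π * σ) := cos_pos_of_mem_Ioo ⟨by nlinarith, by nlinarith⟩
  rw [show π * (2 * σ) = 2 * (π * σ) by ring, sin_two_mul] at h2
  have g1 := Gamma_pos_of_pos hσ
  have g2 := Gamma_pos_of_pos (s := 1 - σ) (by linarith)
  have g3 := Gamma_pos_of_pos (s := 2 * σ) (by linarith)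
  rw [ProbabilityTheory.beta, ProbabilityTheory.beta, show σ + (1 - 2 * σ) = 1 - σ by ring,
    ← two_mul, mul_comm σ π]
  rw [eq_div_iff (by positivity)] at h1 h2
  rw [← mul_div_assoc, div_eq_div_iff g3.ne' g2.ne']
  apply mul_right_cancel₀ hs.ne'
  linear_combination Gamma σ * h1 - Gamma σ * h2

lemma beta_eq_two_mul_cos_mul_neg_beta {σ : ℝ} (hσ : 1 / 2 < σ) (hσ' : σ < 1) :
    ProbabilityTheory.beta σ σ = 2 * cos (σ * π) *
      -((1 - σ) * ProbabilityTheory.beta σ (2 - 2 * σ) / (2 * σ - 1)) := by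
  have h1 := Gamma_mul_Gamma_one_sub σ
  have h2 := Gamma_mul_Gamma_one_sub (2 * σ - 1)
  have hπ := pi_pos
  have hs : 0 < sin (π * σ) := sin_pos_of_pos_of_lt_pi (by nlinarith) (by nlinarith)
  have hc : cos (π * σ) < 0 := cos_neg_of_pi_div_two_lt_of_lt (by nlinarith) (by nlinarith)
  rw [show π * (2 * σ - 1) = 2 * (π * σ) - π by ring, sin_sub_pi, sin_two_mul,
    show 1 - (2 * σ - 1) = 2 - 2 * σ by ring] at h2
  have hd : 0 < 2 * σ - 1 := by linarith
  have hd' : 0 < 1 - σ := by linarith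
  have g1 := Gamma_pos_of_pos (show 0 < σ by linarith)
  have g2 := Gamma_pos_of_pos hd'
  have g3 := Gamma_pos_of_pos hd
  have e1 : Gamma (σ + (2 - 2 * σ)) = (1 - σ) * Gamma (1 - σ) := by
    rw [← Gamma_add_one hd'.ne']; ring_nf
  have e2 : Gamma (σ + σ) = (2 * σ - 1) * Gamma (2 * σ - 1) := by
    rw [← Gamma_add_one hd.ne']; ring_nf
  rw [ProbabilityTheory.beta, ProbabilityTheory.beta, e1, e2, mul_comm σ π]
  rw [eq_div_iff (by nlinarith)] at h1 h2
  have h3 : Gamma σ * Gamma (1 - σ) =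
      -(2 * cos (π * σ) * Gamma (2 - 2 * σ) * Gamma (2 * σ - 1)) := by
    apply mul_right_cancel₀ hs.ne'
    linear_combination h1 - h2
  generalize Gamma (2 - 2 * σ) = G at *
  generalize cos (π * σ) = c at *
  field_simp
  linear_combination h3

lemma RLIL_eq_integral_posPow (σ : ℝ) (w : ℝ → ℝ) (x : ℝ) :
    RLIL σ w x = (1 / Gamma σ) * ∫ s, w s * posPow (σ - 1) (x - s) := by
  rw [RLIL, ← integral_indicator measurableSet_Iio]
  congr 2
  ext s
  by_cases hs : s < x
  · rw [Set.indicator_of_mem (Set.mem_Iio.2 hs), posPow_of_pos (sub_pos.2 hs), mul_comm]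
  · rw [Set.indicator_of_notMem (by simpa using hs), posPow_of_nonpos (by linarith), mul_zero]

lemma RLIR_eq_integral_posPow (σ : ℝ) (w : ℝ → ℝ) (x : ℝ) :
    RLIR σ w x = (1 / Gamma σ) * ∫ s, w s * posPow (σ - 1) (s - x) := by
  rw [RLIR, ← integral_indicator measurableSet_Ioi]
  congr 2
  ext s
  by_cases hs : x < s
  · rw [Set.indicator_of_mem (Set.mem_Ioi.2 hs), posPow_of_pos (sub_pos.2 hs), mul_comm]
  · rw [Set.indicator_of_notMem (by simpa using hs), posPow_of_nonpos (by linarith), mul_zero]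

open scoped Convolution in
lemma hasDerivAt_integral_mul_comp_sub {P w : ℝ → ℝ} (hP : LocallyIntegrable P)
    (hw : ContDiff ℝ 1 w) (hws : HasCompactSupport w) (x : ℝ) :
    HasDerivAt (fun x => ∫ s, w s * P (x - s)) (∫ s, deriv w s * P (x - s)) x := by
  have h := hws.hasDerivAt_convolution_right (ContinuousLinearMap.mul ℝ ℝ) hP hw x
  have e : ∀ u : ℝ → ℝ, (P ⋆[ContinuousLinearMap.mul ℝ ℝ, volume] u)
      = fun x => ∫ s, u s * P (x - s) := by
    intro u
    ext x
    rw [convolution_eq_swap]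
    simp only [ContinuousLinearMap.mul_apply', mul_comm]
  rwa [e, e] at h

lemma deriv_RLIL {σ : ℝ} (hσ : 0 < σ) {w : ℝ → ℝ} (hw : ContDiff ℝ 1 w)
    (hws : HasCompactSupport w) : deriv (RLIL σ w) = RLIL σ (deriv w) := by
  ext x
  rw [funext (RLIL_eq_integral_posPow σ w), RLIL_eq_integral_posPow]
  exact ((hasDerivAt_integral_mul_comp_sub (locallyIntegrable_posPow (by linarith)) hw hws
    x).const_mul _).deriv

lemma deriv_RLIR {σ : ℝ} (hσ : 0 < σ) {w : ℝ → ℝ} (hw : ContDiff ℝ 1 w)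
    (hws : HasCompactSupport w) : deriv (RLIR σ w) = RLIR σ (deriv w) := by
  ext x
  rw [funext (RLIR_eq_integral_posPow σ w), RLIR_eq_integral_posPow]
  have := ((hasDerivAt_integral_mul_comp_sub (locallyIntegrable_posPow_neg (p := σ - 1)
    (by linarith)) hw hws x).const_mul (1 / Gamma σ)).deriv
  simpa only [neg_sub] using this

lemma contDiff_iterate_deriv_and_hasCompactSupport {w : ℝ → ℝ} (hw : ContDiff ℝ (⊤ : ℕ∞) w)
    (hws : HasCompactSupport w) (n : ℕ) :
    ContDiff ℝ (⊤ : ℕ∞) (deriv^[n] w) ∧ HasCompactSupport (deriv^[n] w) := by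
  induction n with
  | zero => exact ⟨hw, hws⟩
  | succ n ih =>
    rw [Function.iterate_succ_apply']
    exact ⟨(contDiff_infty_iff_deriv.1 ih.1).2, ih.2.deriv⟩

lemma iterate_deriv_RLIL {σ : ℝ} (hσ : 0 < σ) {w : ℝ → ℝ} (hw : ContDiff ℝ (⊤ : ℕ∞) w)
    (hws : HasCompactSupport w) (n : ℕ) :
    deriv^[n] (RLIL σ w) = RLIL σ (deriv^[n] w) := by
  induction n with
  | zero => rfl
  | succ n ih =>
    obtain ⟨h1, h2⟩ := contDiff_iterate_deriv_and_hasCompactSupport hw hws n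
    rw [Function.iterate_succ_apply', ih, Function.iterate_succ_apply',
      deriv_RLIL hσ (h1.of_le (by norm_cast)) h2]

lemma iterate_deriv_RLIR {σ : ℝ} (hσ : 0 < σ) {w : ℝ → ℝ} (hw : ContDiff ℝ (⊤ : ℕ∞) w)
    (hws : HasCompactSupport w) (n : ℕ) :
    deriv^[n] (RLIR σ w) = RLIR σ (deriv^[n] w) := by
  induction n with
  | zero => rfl
  | succ n ih =>
    obtain ⟨h1, h2⟩ := contDiff_iterate_deriv_and_hasCompactSupport hw hws n
    rw [Function.iterate_succ_apply', ih, Function.iterate_succ_apply',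
      deriv_RLIR hσ (h1.of_le (by norm_cast)) h2]

lemma integral_deriv_eq_zero_of_hasCompactSupport {w : ℝ → ℝ} (hw : ContDiff ℝ 1 w)
    (hws : HasCompactSupport w) : ∫ x, deriv w x = 0 := by
  have hi : Integrable (deriv w) :=
    (hw.continuous_deriv le_rfl).integrable_of_hasCompactSupport hws.deriv
  rw [← intervalIntegral.integral_Iic_add_Ioi (b := 0) hi.integrableOn hi.integrableOn,
    hws.integral_Iic_deriv_eq hw, hws.integral_Ioi_deriv_eq hw, add_neg_cancel]

lemma integral_RLIL_mul_RLIR {σ : ℝ} {f g : ℝ → ℝ} (hf : Continuous f)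
    (hfs : HasCompactSupport f) (hg : Continuous g) (hgs : HasCompactSupport g)
    (hσ : 0 < σ) :
    ∫ x, RLIL σ f x * RLIR σ g x = (1 / Gamma σ) ^ 2 * (ProbabilityTheory.beta σ σ *
      ∫ z : ℝ × ℝ, f z.1 * g z.2 * posPow (2 * σ - 1) (z.2 - z.1)) := by
  have e : ∀ x, RLIL σ f x * RLIR σ g x = (1 / Gamma σ) ^ 2 * ∫ z : ℝ × ℝ, f z.1 * g z.2 *
      (posPow (σ - 1) (x - z.1) * posPow (σ - 1) (z.2 - x)) := by
    intro x
    rw [RLIL_eq_integral_posPow, RLIR_eq_integral_posPow, mul_mul_mul_comm, ← sq,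
      ← integral_prod_mul]
    simp only [mul_mul_mul_comm, Measure.volume_eq_prod]
  simp_rw [e]
  rw [integral_const_mul, (isKernelIntegral_left_right hσ).integral_integral (by fun_prop)
    (by linarith) hf hfs hg hgs]
  congr 1
  rw [← integral_const_mul]
  congr 1
  ext z
  ring

lemma integral_RLIL_mul_RLIR_add_swap_eq {σ : ℝ} {f g : ℝ → ℝ} (hf : Continuous f)
    (hfs : HasCompactSupport f) (hg : Continuous g) (hgs : HasCompactSupport g)
    (hσ : 0 < σ) :
    (∫ x, RLIL σ f x * RLIR σ g x) + (∫ x, RLIL σ g x * RLIR σ f x)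
      = (1 / Gamma σ) ^ 2 * (ProbabilityTheory.beta σ σ *
        ∫ z : ℝ × ℝ, f z.1 * g z.2 * |z.1 - z.2| ^ (2 * σ - 1)) := by
  have hi := integrable_mul_mul_abs_sub_rpow hf hfs hg hgs (p := 2 * σ - 1) (by linarith)
  have hfm := hf.measurable
  have hgm := hg.measurable
  have hle : ∀ u : ℝ, |posPow (2 * σ - 1) u| ≤ |u| ^ (2 * σ - 1) := by
    intro u
    rcases le_or_gt u 0 with hu | hu
    · rw [posPow_of_nonpos hu, abs_zero]
      positivity
    · rw [posPow_of_pos hu, abs_of_pos hu, abs_of_pos (by positivity)]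
  have i1 : Integrable fun z : ℝ × ℝ => f z.1 * g z.2 * posPow (2 * σ - 1) (z.2 - z.1) := by
    refine hi.mono (by fun_prop) (ae_of_all _ fun z => ?_)
    rw [norm_mul, norm_mul (f z.1 * g z.2), norm_eq_abs (posPow _ _), norm_eq_abs (_ ^ _),
      abs_of_nonneg (a := |z.1 - z.2| ^ _) (by positivity), abs_sub_comm]
    exact mul_le_mul_of_nonneg_left (hle _) (norm_nonneg _)
  have i2 : Integrable fun z : ℝ × ℝ => f z.1 * g z.2 * posPow (2 * σ - 1) (z.1 - z.2) := by
    refine hi.mono (by fun_prop) (ae_of_all _ fun z => ?_)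
    rw [norm_mul, norm_mul (f z.1 * g z.2), norm_eq_abs (posPow _ _), norm_eq_abs (_ ^ _),
      abs_of_nonneg (a := |z.1 - z.2| ^ _) (by positivity)]
    exact mul_le_mul_of_nonneg_left (hle _) (norm_nonneg _)
  have hswap : ∫ z : ℝ × ℝ, g z.1 * f z.2 * posPow (2 * σ - 1) (z.2 - z.1)
      = ∫ z : ℝ × ℝ, f z.1 * g z.2 * posPow (2 * σ - 1) (z.1 - z.2) := by
    rw [Measure.volume_eq_prod, ← integral_prod_swap]
    simp only [Prod.fst_swap, Prod.snd_swap, mul_comm (g _)]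
  rw [integral_RLIL_mul_RLIR hf hfs hg hgs hσ, integral_RLIL_mul_RLIR hg hgs hf hfs hσ, hswap,
    ← mul_add, ← mul_add, ← integral_add i1 i2]
  congr 2
  refine integral_congr_ae ?_
  filter_upwards [ae_fst_ne_snd] with z hz
  rcases lt_or_gt_of_ne hz with h | h
  · rw [posPow_of_pos (sub_pos.2 h), posPow_of_nonpos (sub_nonpos.2 h.le), abs_sub_comm,
      abs_of_pos (sub_pos.2 h), mul_zero, add_zero]
  · rw [posPow_of_pos (sub_pos.2 h), posPow_of_nonpos (sub_nonpos.2 h.le),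
      abs_of_pos (sub_pos.2 h), mul_zero, zero_add]

lemma integral_RLIL_mul_RLIL_of_lt_half {σ : ℝ} {f g : ℝ → ℝ} (hf : Continuous f)
    (hfs : HasCompactSupport f) (hg : Continuous g) (hgs : HasCompactSupport g)
    (hσ : 0 < σ) (hσ' : σ < 1 / 2) :
    ∫ x, RLIL σ f x * RLIL σ g x
      = (1 / Gamma σ) ^ 2 * (ProbabilityTheory.beta σ (1 - 2 * σ) *
        ∫ z : ℝ × ℝ, f z.1 * g z.2 * |z.1 - z.2| ^ (2 * σ - 1)) := by
  have e : ∀ x, RLIL σ f x * RLIL σ g x = (1 / Gamma σ) ^ 2 * ∫ z : ℝ × ℝ, f z.1 * g z.2 *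
      (posPow (σ - 1) (x - z.1) * posPow (σ - 1) (x - z.2)) := by
    intro x
    rw [RLIL_eq_integral_posPow, RLIL_eq_integral_posPow, mul_mul_mul_comm, ← sq,
      ← integral_prod_mul]
    simp only [mul_mul_mul_comm, Measure.volume_eq_prod]
  simp_rw [e]
  rw [integral_const_mul, (isKernelIntegral_left_left hσ hσ').integral_integral (by fun_prop)
    (by linarith) hf hfs hg hgs]
  congr 1
  rw [← integral_const_mul]
  congr 1
  ext z
  ring

lemma integral_RLIL_mul_RLIL_of_half_lt {σ : ℝ} {f g : ℝ → ℝ} (hf : Continuous f)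
    (hfs : HasCompactSupport f) (hg : Continuous g) (hgs : HasCompactSupport g)
    (hg0 : ∫ x, g x = 0) (hσ : 1 / 2 < σ) (hσ' : σ < 1) :
    ∫ x, RLIL σ f x * RLIL σ g x
      = (1 / Gamma σ) ^ 2 *
        (-((1 - σ) * ProbabilityTheory.beta σ (2 - 2 * σ) / (2 * σ - 1)) *
        ∫ z : ℝ × ℝ, f z.1 * g z.2 * |z.1 - z.2| ^ (2 * σ - 1)) := by
  have hP : ∀ {u : ℝ → ℝ}, Continuous u → HasCompactSupport u → ∀ {p : ℝ}, -1 < p → ∀ x,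
      Integrable fun s => u s * posPow p (x - s) := by
    intro u hu hus p hp x
    have h1 : Integrable (fun s => posPow p s * u (x - s)) :=
      hus.convolutionExists_right (ContinuousLinearMap.mul ℝ ℝ) (locallyIntegrable_posPow hp) hu x
    simpa [mul_comm] using h1.comp_sub_left x
  have e : ∀ x, RLIL σ f x * RLIL σ g x = (1 / Gamma σ) ^ 2 * ∫ z : ℝ × ℝ, f z.1 * g z.2 *
      (posPow (σ - 1) (x - z.1) * posPow (σ - 1) (x - z.2) - posPow (2 * σ - 2) (x - z.1)) := by
    intro x
    have ig : Integrable g := hg.integrable_of_hasCompactSupport hgs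
    have i1 := (hP hf hfs (p := σ - 1) (by linarith) x).mul_prod
      (hP hg hgs (p := σ - 1) (by linarith) x)
    have i2 := (hP hf hfs (p := 2 * σ - 2) (by linarith) x).mul_prod ig
    have h2 : ∫ z : ℝ × ℝ, f z.1 * posPow (2 * σ - 2) (x - z.1) * g z.2 ∂(volume.prod volume)
        = 0 := by
      rw [integral_prod_mul (fun s => f s * posPow (2 * σ - 2) (x - s)) g, hg0, mul_zero]
    rw [RLIL_eq_integral_posPow, RLIL_eq_integral_posPow, mul_mul_mul_comm, ← sq,
      ← integral_prod_mul]
    rw [← sub_zero (∫ z : ℝ × ℝ, _ ∂(volume.prod volume)), ← h2, ← integral_sub i1 i2]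
    congr 2
    ext z
    ring
  simp_rw [e]
  rw [integral_const_mul, (isKernelIntegral_left_left_sub hσ hσ').integral_integral
    (by fun_prop) (by linarith) hf hfs hg hgs]
  congr 1
  rw [← integral_const_mul]
  congr 1
  ext z
  ring

lemma integral_RLIL_mul_RLIR_add_swap {σ : ℝ} {f g : ℝ → ℝ} (hf : Continuous f)
    (hfs : HasCompactSupport f) (hg : Continuous g) (hgs : HasCompactSupport g)
    (hf0 : ∫ x, f x = 0) (hg0 : ∫ x, g x = 0) (hσ : 0 < σ)
    (hσ1 : σ ≤ 1) :
    (∫ x, RLIL σ f x * RLIR σ g x) + (∫ x, RLIL σ g x * RLIR σ f x)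
      = 2 * cos (σ * π) * ∫ x, RLIL σ f x * RLIL σ g x := by
  rcases hσ1.lt_or_eq with hlt | rfl
  · rw [integral_RLIL_mul_RLIR_add_swap_eq hf hfs hg hgs hσ]
    rcases lt_trichotomy σ (1 / 2) with h | rfl | h
    · rw [integral_RLIL_mul_RLIL_of_lt_half hf hfs hg hgs hσ h, beta_eq_two_mul_cos_mul_beta hσ h]
      ring
    · have h0 : ∫ z : ℝ × ℝ, f z.1 * g z.2 = 0 := by
        rw [Measure.volume_eq_prod, integral_prod_mul, hf0, zero_mul]
      rw [show (1 / 2 : ℝ) * π = π / 2 by ring, cos_pi_div_two,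
        show 2 * (1 / 2 : ℝ) - 1 = 0 by norm_num]
      simp only [rpow_zero, mul_one, h0, mul_zero, zero_mul]
    · rw [integral_RLIL_mul_RLIL_of_half_lt hf hfs hg hgs hg0 h hlt,
        beta_eq_two_mul_cos_mul_neg_beta h hlt]
      ring
  · have hR : ∀ {u : ℝ → ℝ}, Continuous u → HasCompactSupport u → ∫ x, u x = 0 →
        ∀ x, RLIR 1 u x = -RLIL 1 u x := by
      intro u hu hus hu0 x
      have iu : Integrable u := hu.integrable_of_hasCompactSupport hus
      have := intervalIntegral.integral_Iic_add_Ioi (b := x) iu.integrableOn iu.integrableOn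
      simp only [RLIR, RLIL, sub_self, rpow_zero, one_mul, Gamma_one, div_one]
      rw [← integral_Iic_eq_integral_Iio]
      linarith
    simp_rw [hR hf hfs hf0, hR hg hgs hg0, one_mul, cos_pi, mul_neg, integral_neg,
      mul_comm (RLIL 1 g _)]
    ring

theorem stmt12 (μ : ℝ) (hμ : 0 ≤ μ) (v w : ℝ → ℝ)
    (hv : ContDiff ℝ (⊤ : ℕ∞) v) (hvs : HasCompactSupport v)
    (hw : ContDiff ℝ (⊤ : ℕ∞) w) (hws : HasCompactSupport w) :
    (∫ x, RLDL μ v x * RLDR μ w x) + (∫ x, RLDL μ w x * RLDR μ v x)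
      = 2 * Real.cos (μ * π) * ∫ x, RLDL μ v x * RLDL μ w x := by
  rcases eq_or_ne μ 0 with rfl | hμ0
  · simp only [RLDL, RLDR, if_true, zero_mul, cos_zero, mul_one, mul_comm (w _), two_mul]
  set n := ⌊μ⌋₊ + 1 with hn
  set σ := (⌊μ⌋₊ : ℝ) + 1 - μ with hσdef
  have hσ : 0 < σ := by linarith [Nat.lt_floor_add_one μ]
  have hσ1 : σ ≤ 1 := by linarith [Nat.floor_le hμ]
  have hL : ∀ {u : ℝ → ℝ}, ContDiff ℝ (⊤ : ℕ∞) u → HasCompactSupport u →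
      RLDL μ u = RLIL σ (deriv^[n] u) := fun hu hus => by
    rw [RLDL, if_neg hμ0, iterate_deriv_RLIL hσ hu hus]
  have hR : ∀ {u : ℝ → ℝ}, ContDiff ℝ (⊤ : ℕ∞) u → HasCompactSupport u →
      RLDR μ u = fun x => (-1) ^ n * RLIR σ (deriv^[n] u) x := fun hu hus => by
    rw [RLDR, if_neg hμ0, iterate_deriv_RLIR hσ hu hus]
  have h0 : ∀ {u : ℝ → ℝ}, ContDiff ℝ (⊤ : ℕ∞) u → HasCompactSupport u →
      ∫ x, (deriv^[n] u) x = 0 := fun hu hus => by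
    obtain ⟨h1, h2⟩ := contDiff_iterate_deriv_and_hasCompactSupport hu hus ⌊μ⌋₊
    rw [hn, Function.iterate_succ_apply']
    exact integral_deriv_eq_zero_of_hasCompactSupport
      (h1.of_le (by norm_cast)) h2
  obtain ⟨cv, sv⟩ := contDiff_iterate_deriv_and_hasCompactSupport hv hvs n
  obtain ⟨cw, sw⟩ := contDiff_iterate_deriv_and_hasCompactSupport hw hws n
  have hcos : cos (μ * π) = (-1) ^ n * cos (σ * π) := by
    rw [← cos_nat_mul_pi_sub]
    congr 1
    rw [hn, hσdef]
    push_cast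
    ring
  have key := integral_RLIL_mul_RLIR_add_swap cv.continuous sv cw.continuous sw (h0 hv hvs)
    (h0 hw hws) hσ hσ1
  rw [hL hv hvs, hL hw hws, hR hv hvs, hR hw hws, hcos]
  simp only [mul_left_comm (RLIL σ _ _) ((-1) ^ n) (RLIR σ _ _), integral_const_mul]
  linear_combination (-1) ^ n * key

end
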